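/- Let Y_1,…,Y_n be pairwise commuting linear vector fields on ℝⁿ with coefficient matrix ℓ, D = det ℓ ≠ 0, and div Y_i the divergences. Then D is, up to a nonzero real multiple, the unique nonzero polynomial P on ℝⁿ satisfying Y_i P = (div Y_i) P for all i: any such P equals α D for some α ∈ ℝ*. -/

import Mathlib

open MvPolynomial

/-- The action of the linear vector field `Y = Σ_{r,s} A r s • x_s ∂_r` on polynomials. -/
noncomputable def linVF {n : ℕ} (A : Matrix (Fin n) (Fin n) ℝ)
    (P : MvPolynomial (Fin n) ℝ) : MvPolynomial (Fin n) ℝ :=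
  ∑ r, (∑ s, C (A r s) * X s) * pderiv r P

/-- The matrix `ℓ` of coefficient linear forms of the vector fields `Y_i`. -/
noncomputable def coeffMat {n : ℕ} (a : Fin n → Matrix (Fin n) (Fin n) ℝ) :
    Matrix (Fin n) (Fin n) (MvPolynomial (Fin n) ℝ) :=
  fun i r => ∑ s, C (a i r s) * X s

open Finset in
/-- The Leibniz rule for a finite product. -/
theorem Derivation.map_prod_eq_sum_erase {R A ι : Type*} [CommSemiring R] [CommSemiring A]
    [Algebra R A] [DecidableEq ι] (D : Derivation R A A) (s : Finset ι) (f : ι → A) :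
    D (∏ i ∈ s, f i) = ∑ i ∈ s, (∏ j ∈ s.erase i, f j) * D (f i) := by
  induction s using Finset.induction_on with
  | empty => simp
  | insert a s ha ih =>
    rw [prod_insert ha, D.leibniz, ih, sum_insert ha, erase_insert ha, smul_eq_mul, smul_eq_mul,
      add_comm, mul_sum]
    congr 1
    refine sum_congr rfl fun i hi => ?_
    have hai : a ≠ i := fun h => ha (h ▸ hi)
    rw [erase_insert_of_ne hai, prod_insert (fun h => ha (mem_of_mem_erase h)), mul_assoc]

open Finset in
/-- A derivation acts on a determinant column by column. -/
theorem Derivation.map_det {R A m : Type*} [CommRing R] [CommRing A] [Algebra R A] [Fintype m]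
    [DecidableEq m] (D : Derivation R A A) (M : Matrix m m A) :
    D M.det = ∑ j, (M.updateCol j fun i => D (M i j)).det := by
  simp_rw [Matrix.det_apply]
  rw [map_sum, sum_comm]
  refine sum_congr rfl fun σ _ => ?_
  rw [← smul_sum, Units.smul_def, map_zsmul, ← Units.smul_def, D.map_prod_eq_sum_erase]
  congr 1
  refine sum_congr rfl fun j _ => ?_
  rw [← mul_prod_erase univ _ (mem_univ j), Matrix.updateCol_self, mul_comm]
  congr 1
  refine prod_congr rfl fun i hi => ?_
  rw [Matrix.updateCol_ne (ne_of_mem_erase hi)]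

/-- If a derivation acts on the matrix `M` as right multiplication by `B`, it acts on `det M` as
multiplication by the trace of `B`. -/
theorem Derivation.map_det_of_map_eq_mul {R A m : Type*} [CommRing R] [CommRing A] [Algebra R A]
    [Fintype m] [DecidableEq m] (D : Derivation R A A) (M B : Matrix m m A)
    (h : M.map D = M * B) : D M.det = B.trace * M.det := by
  rw [D.map_det, Matrix.trace, Finset.sum_mul]
  refine Finset.sum_congr rfl fun j _ => ?_
  rw [Matrix.diag_apply, ← smul_eq_mul, ← Matrix.det_updateCol_sum M j fun i => B i j]
  congr 2
  funext k
  have hk := congrFun (congrFun h k) j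
  rw [Matrix.map_apply, Matrix.mul_apply] at hk
  rw [hk]
  exact Finset.sum_congr rfl fun i _ => mul_comm _ _

namespace MvPolynomial

theorem totalDegree_pderiv_lt {σ R : Type*} [CommSemiring R] {p : MvPolynomial σ R} {i : σ}
    (h : pderiv i p ≠ 0) : (pderiv i p).totalDegree < p.totalDegree := by
  obtain ⟨m, hm, hdeg⟩ := Finset.exists_mem_eq_sup _ (support_nonempty.mpr h)
    (fun m : σ →₀ ℕ => m.sum fun _ e => e)
  rw [mem_support_iff, coeff_pderiv] at hm
  have hle := le_totalDegree (mem_support_iff.mpr (left_ne_zero_of_mul hm))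
  rw [Finsupp.sum_add_index' (fun _ => rfl) (fun _ _ _ => rfl),
    Finsupp.sum_single_index rfl] at hle
  rw [totalDegree, hdeg]
  exact hle

theorem pderiv_eq_zero_of_dvd {σ R : Type*} [CommRing R] [IsDomain R] {p : MvPolynomial σ R}
    {i : σ} (h : p ∣ pderiv i p) : pderiv i p = 0 := by
  by_contra h0
  exact (totalDegree_pderiv_lt h0).not_ge (totalDegree_le_of_dvd_of_isDomain h h0)

theorem eq_C_of_pderiv_eq_zero {σ R : Type*} [CommRing R] [IsDomain R] [CharZero R]
    {p : MvPolynomial σ R} (h : ∀ i, pderiv i p = 0) : p = C (coeff 0 p) := by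
  classical
  ext m
  rw [coeff_C]
  split_ifs with hm
  · rw [hm]
  · obtain ⟨i, hi⟩ := Finsupp.ne_iff.mp (Ne.symm hm)
    have hc := coeff_pderiv (i := i) p (m - Finsupp.single i 1)
    have hle : Finsupp.single i 1 ≤ m :=
      Finsupp.single_le_iff.mpr (Nat.one_le_iff_ne_zero.mpr hi)
    rw [h i, coeff_zero, tsub_add_cancel_of_le hle] at hc
    exact (mul_eq_zero.mp hc.symm).resolve_right (Nat.cast_add_one_ne_zero _)

/-- Nonzero polynomials with the same logarithmic derivatives are proportional. -/
theorem exists_eq_C_mul_of_mul_pderiv_eq {σ K : Type*} [Field K] [CharZero K]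
    {p q : MvPolynomial σ K} (hp : p ≠ 0) (hq : q ≠ 0)
    (h : ∀ i, q * pderiv i p = p * pderiv i q) : ∃ c : K, c ≠ 0 ∧ p = C c * q := by
  obtain ⟨p', q', g, hrel, rfl, rfl⟩ :=
    UniqueFactorizationMonoid.exists_reduced_factors p hp q
  have hg : g ≠ 0 := left_ne_zero_of_mul hp
  have hcop : ∀ i, q' * pderiv i p' = p' * pderiv i q' := fun i => by
    have hi := h i
    simp only [pderiv_mul] at hi
    refine mul_left_cancel₀ (mul_ne_zero hg hg) ?_
    linear_combination hi
  have hp' : p' = C (coeff 0 p') := eq_C_of_pderiv_eq_zero fun i =>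
    pderiv_eq_zero_of_dvd (hrel.dvd_of_dvd_mul_left ⟨_, hcop i⟩)
  have hq' : q' = C (coeff 0 q') := eq_C_of_pderiv_eq_zero fun i =>
    pderiv_eq_zero_of_dvd (hrel.symm.dvd_of_dvd_mul_left ⟨_, (hcop i).symm⟩)
  have hp0 : coeff 0 p' ≠ 0 := fun h0 => hp (by rw [hp', h0, C_0, mul_zero])
  have hq0 : coeff 0 q' ≠ 0 := fun h0 => hq (by rw [hq', h0, C_0, mul_zero])
  refine ⟨coeff 0 p' / coeff 0 q', div_ne_zero hp0 hq0, ?_⟩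
  have hC : C (coeff 0 p' / coeff 0 q') * q' = p' := by
    calc C (coeff 0 p' / coeff 0 q') * q' = C (coeff 0 p' / coeff 0 q') * C (coeff 0 q') :=
          congrArg _ hq'
      _ = p' := by rw [← C_mul, div_mul_cancel₀ _ hq0, ← hp']
  rw [mul_left_comm, hC]

end MvPolynomial

theorem exists_derivation_eq_linVF {n : ℕ} (A : Matrix (Fin n) (Fin n) ℝ) :
    ∃ D : Derivation ℝ (MvPolynomial (Fin n) ℝ) (MvPolynomial (Fin n) ℝ), ∀ P, D P = linVF A P := by
  refine ⟨∑ r, (∑ s, C (A r s) * X s : MvPolynomial (Fin n) ℝ) • pderiv r, fun P => ?_⟩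
  rw [← Derivation.coeFnAddMonoidHom_apply, map_sum, Finset.sum_apply]
  rfl

theorem linVF_X {n : ℕ} (A : Matrix (Fin n) (Fin n) ℝ) (r : Fin n) :
    linVF A (X r) = ∑ s, C (A r s) * X s := by
  classical
  simp [linVF, pderiv_X, Pi.single_apply]

theorem linVF_det_coeffMat {n : ℕ} (a : Fin n → Matrix (Fin n) (Fin n) ℝ)
    (hcomm : ∀ i j P, linVF (a i) (linVF (a j) P) = linVF (a j) (linVF (a i) P)) (i : Fin n) :
    linVF (a i) (coeffMat a).det = C (Matrix.trace (a i)) * (coeffMat a).det := by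
  obtain ⟨D, hDer⟩ := exists_derivation_eq_linVF (a i)
  rw [← hDer, D.map_det_of_map_eq_mul (coeffMat a) ((a i).transpose.map C)]
  · simp [Matrix.trace]
  · ext1 j r
    obtain ⟨E, hE⟩ := exists_derivation_eq_linVF (a j)
    have hX : coeffMat a j r = linVF (a j) (X r) := (linVF_X _ _).symm
    rw [Matrix.map_apply, hDer, hX, hcomm, linVF_X, ← hE, map_sum, Matrix.mul_apply]
    refine Finset.sum_congr rfl fun s _ => ?_
    rw [← smul_eq_C_mul, E.map_smul, hE, linVF_X, smul_eq_C_mul, mul_comm]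
    rfl

/-- If `Y_1, …, Y_n` are pairwise commuting linear vector fields on `ℝⁿ` with `D = det ℓ ≠ 0`,
then `D` is, up to a nonzero real multiple, the unique nonzero polynomial `P` with
`Y_i P = (div Y_i) P` for all `i`. -/
theorem joint_eigenvector_unique {n : ℕ} (a : Fin n → Matrix (Fin n) (Fin n) ℝ)
    (hcomm : ∀ i j P, linVF (a i) (linVF (a j) P) = linVF (a j) (linVF (a i) P))
    (hD : (coeffMat a).det ≠ 0)
    (P : MvPolynomial (Fin n) ℝ) (hP : P ≠ 0)
    (hE : ∀ i, linVF (a i) P = C (Matrix.trace (a i)) * P) :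
    ∃ α : ℝ, α ≠ 0 ∧ P = C α * (coeffMat a).det := by
  refine exists_eq_C_mul_of_mul_pderiv_eq hP hD fun r => ?_
  have hker : (coeffMat a).mulVec (fun r => (coeffMat a).det * pderiv r P -
      P * pderiv r (coeffMat a).det) = 0 := by
    funext i
    have hmul : ∀ Q : MvPolynomial (Fin n) ℝ, ∑ r, coeffMat a i r * pderiv r Q = linVF (a i) Q := fun Q => rfl
    have hPD : (coeffMat a).det * linVF (a i) P - P * linVF (a i) (coeffMat a).det = 0 := by
      rw [hE, linVF_det_coeffMat a hcomm]
      ring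
    rw [Pi.zero_apply, Matrix.mulVec, dotProduct, ← hPD, ← hmul, ← hmul, Finset.mul_sum, Finset.mul_sum,
      ← Finset.sum_sub_distrib]
    refine Finset.sum_congr rfl fun r _ => ?_
    ring
  exact sub_eq_zero.mp (congrFun (Matrix.eq_zero_of_mulVec_eq_zero hD hker) r)
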